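/- Let p ≥ 3 and let λ ∈ ℂ_p be not a root of unity with 0 < |1-λ| < 1, and let s, t, γ₀ be as defined (with m = 1). Then: (1) for every integer n ≥ s+1, κ_n = -1/p^n; (2) if s ≥ 1, then κ_s = -(s-t)·p^{-s} - p^{-(s-t)}·ν(γ₀ - λ) + (1/p)·ν(1-λ); (3) if s ≥ 2 and 1 ≤ n ≤ s-1, then κ_n = -((p-1)/p)·ν(1-λ). -/

import Mathlib

open scoped BigOperators

noncomputable section

/-- `R(s) = p^{-1/(p^{s-1}(p-1))}` for `s ≥ 1`, and `R(0) = 0`. -/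
def Rr (p : ℕ) (s : ℕ) : ℝ :=
  if s = 0 then 0 else (p : ℝ) ^ (-(1 : ℝ) / ((p : ℝ) ^ (s - 1) * ((p : ℝ) - 1)))

/-- The group `Γ_r` of `p`-power roots of unity. -/
def GammaR (p : ℕ) (K : Type*) [Monoid K] : Set K := {z | ∃ k : ℕ, z ^ p ^ k = 1}

/-- The quantity `r̃(λ)`. -/
def rTilde {K : Type*} [NontriviallyNormedField K] (p : ℕ) (lam γ₀ : K) (m s t : ℕ) : ℝ :=
  Rr p (s + 1) ^ ((1 : ℝ) / m) *
    (p : ℝ) ^ (-(((s : ℝ) - (t : ℝ)) / ((m : ℝ) * (p : ℝ) ^ s))) *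
    ‖1 - lam ^ m‖ ^ ((s : ℝ) * ((p : ℝ) - 1) / ((m : ℝ) * (p : ℝ))) *
    ‖γ₀ - lam ^ m‖ ^ ((1 : ℝ) / ((m : ℝ) * (p : ℝ) ^ ((s : ℝ) - (t : ℝ))))

/-- Coefficient of `x^k` in the formal composition `H ∘ F`, where `H, F` are given by their
coefficient sequences `b, c` and `F` has zero constant term. -/
def compCoeff {K : Type*} [Field K] (b c : ℕ → K) (k : ℕ) : K :=
  ∑ l ∈ Finset.range (k + 1), b l * PowerSeries.coeff k ((PowerSeries.mk c) ^ l)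

/-- `b` is (the coefficient sequence of) the normalized formal linearizing conjugacy `H_f` for the
power series `f` with coefficient sequence `c`: `H(0)=0`, `H'(0)=1` and `H ∘ f = λ·H` as formal
power series. -/
def IsConjugacy {K : Type*} [Field K] (lam : K) (c b : ℕ → K) : Prop :=
  b 0 = 0 ∧ b 1 = 1 ∧ ∀ k, compCoeff b c k = lam * b k

/-- Evaluation of the power series with coefficients `b` at `x`. -/
def pEval {K : Type*} [NontriviallyNormedField K] (b : ℕ → K) (x : K) : K :=
  ∑' k, b k * x ^ k

/-- `f` is analytically linearizable on `U` (a disk about `0`): `f` maps `U` to itself and some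
convergent power series `h` with `h(0)=0`, `h'(0)=1` maps `U` bijectively onto itself and
conjugates `f` to `x ↦ λx` on `U`. -/
def LinearizableOn {K : Type*} [NontriviallyNormedField K] (f : K → K) (lam : K)
    (U : Set K) : Prop :=
  Set.MapsTo f U U ∧
    ∃ b : ℕ → K, b 0 = 0 ∧ b 1 = 1 ∧
      (∀ x ∈ U, Summable fun k => b k * x ^ k) ∧
      Set.BijOn (pEval b) U U ∧
      ∀ x ∈ U, pEval b (f x) = lam * pEval b x

/-- A disk about `0`: an open or closed ball centered at the origin. -/
def IsZeroDisk {K : Type*} [NontriviallyNormedField K] (U : Set K) : Prop :=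
  ∃ ρ : ℝ, U = Metric.ball (0 : K) ρ ∨ U = Metric.closedBall (0 : K) ρ

/-- `x` is a periodic point of `f` of minimal period `q`. -/
def IsMinPeriodicPt {K : Type*} (f : K → K) (q : ℕ) (x : K) : Prop :=
  f^[q] x = x ∧ ∀ j, 1 ≤ j → j < q → f^[j] x ≠ x

/-- The valuation `ν(x) = -log_p |x|`. -/
def nuP {K : Type*} [NontriviallyNormedField K] (p : ℕ) (z : K) : ℝ :=
  -Real.logb p ‖z‖

/-- `κ_n = -(ν(1-λ^{p^n}) - ν(1-λ^{p^{n-1}}))/p^n`. -/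
def kappaN {K : Type*} [NontriviallyNormedField K] (p : ℕ) (lam : K) (n : ℕ) : ℝ :=
  -(nuP p (1 - lam ^ p ^ n) - nuP p (1 - lam ^ p ^ (n - 1))) / (p : ℝ) ^ n

open Classical in
/-- The multiplicity of `x` as a zero of the analytic function `g`. -/
def analyticMult {K : Type*} [NontriviallyNormedField K] (g : K → K) (x : K) : ℕ :=
  if h : AnalyticAt K g x then (analyticOrderAt g x).toNat else 0

/-- The radius `r(P_λ) = |1-λ|^{-1/p}·r̃(λ)` of quadratic linearization disks. -/
def rQuad {K : Type*} [NontriviallyNormedField K] (p : ℕ) (lam γ₀ : K) (m s t : ℕ) : ℝ :=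
  ‖1 - lam‖ ^ (-(1 : ℝ) / (p : ℝ)) * rTilde p lam γ₀ m s t

/-- The quantity `Ψ(λ) = |1-λ|^{-1/p}·p^{-(s-t)/p^s}·|γ₀-λ|^{1/p^{s-t}}` (case `m = 1`). -/
def PsiL {K : Type*} [NontriviallyNormedField K] (p : ℕ) (lam γ₀ : K) (s t : ℕ) : ℝ :=
  ‖1 - lam‖ ^ (-(1 : ℝ) / (p : ℝ)) *
    (p : ℝ) ^ (-(((s : ℝ) - (t : ℝ)) / (p : ℝ) ^ s)) *
    ‖γ₀ - lam‖ ^ ((1 : ℝ) / (p : ℝ) ^ ((s : ℝ) - (t : ℝ)))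

/-- Coefficient sequence of the quadratic polynomial `P_λ(x) = λx + x²`. -/
def quadCoeff {K : Type*} [Field K] (lam : K) : ℕ → K :=
  fun i => if i = 1 then lam else if i = 2 then 1 else 0

/-- `δ(z) = (k-1)/z - ⌊(k-1)/z⌋` as a rational number. -/
def deltaFrac (k z : ℕ) : ℚ :=
  ((k : ℚ) - 1) / (z : ℚ) - (((k - 1) / z : ℕ) : ℚ)

end

/-- The radii `R(s)` increase strictly. -/
theorem Rr_strictMono {p : ℕ} (hp : 2 ≤ p) : StrictMono (Rr p) := by
  have hp' : (2 : ℝ) ≤ p := by exact_mod_cast hp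
  refine strictMono_nat_of_lt_succ fun n => ?_
  rcases n with _ | n
  · simp only [Rr, if_true, Nat.succ_ne_zero, if_false]
    positivity
  · simp only [Rr, Nat.succ_ne_zero, if_false, Nat.add_sub_cancel]
    apply Real.rpow_lt_rpow_of_exponent_lt (by linarith)
    rw [neg_div, neg_div, neg_lt_neg_iff]
    have h1 : (0 : ℝ) < p - 1 := by linarith
    have h2 : (0 : ℝ) < (p : ℝ) ^ n := by positivity
    apply one_div_lt_one_div_of_lt (by positivity)
    rw [pow_succ]
    nlinarith [mul_pos h2 h1]

theorem norm_eq_one_of_pow_eq_one_of_ne_zero {K : Type*} [NormedField K] {z : K} {n : ℕ}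
    (h : z ^ n = 1) (hn : n ≠ 0) : ‖z‖ = 1 :=
  (isOfFinOrder_iff_pow_eq_one.2 ⟨n, Nat.pos_of_ne_zero hn, h⟩).norm_eq_one

section Cyclotomic

variable {K : Type*} [NontriviallyNormedField K] [CharZero K] [IsAlgClosed K]
  {p : ℕ} [Fact p.Prime]

theorem norm_one_sub_pow_succ (mu : K) (n : ℕ) :
    ‖1 - mu ^ p ^ (n + 1)‖ =
      ‖1 - mu ^ p ^ n‖ * ∏ z ∈ primitiveRoots (p ^ (n + 1)) K, ‖mu - z‖ := by
  have : NeZero (p ^ (n + 1)) := ⟨pow_ne_zero _ (Fact.out : p.Prime).ne_zero⟩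
  obtain ⟨z, hz⟩ := HasEnoughRootsOfUnity.exists_primitiveRoot K (p ^ (n + 1))
  have h := congrArg (Polynomial.eval mu)
    (Polynomial.cyclotomic_prime_pow_mul_X_pow_sub_one K p n)
  rw [Polynomial.cyclotomic_eq_prod_X_sub_primitiveRoots hz, Polynomial.eval_mul,
    Polynomial.eval_prod] at h
  simp only [Polynomial.eval_sub, Polynomial.eval_pow, Polynomial.eval_X, Polynomial.eval_C,
    Polynomial.eval_one] at h
  rw [norm_sub_rev, ← h, norm_mul, norm_prod, mul_comm, norm_sub_rev (mu ^ p ^ n)]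

theorem card_primitiveRoots_prime_pow (n : ℕ) :
    (primitiveRoots (p ^ (n + 1)) K).card = p ^ n * (p - 1) := by
  have : NeZero (p ^ (n + 1)) := ⟨pow_ne_zero _ (Fact.out : p.Prime).ne_zero⟩
  obtain ⟨z, hz⟩ := HasEnoughRootsOfUnity.exists_primitiveRoot K (p ^ (n + 1))
  rw [hz.card_primitiveRoots, Nat.totient_prime_pow_succ Fact.out]

theorem prod_norm_one_sub_primitiveRoots (hnp : ‖(p : K)‖ = (p : ℝ)⁻¹) (n : ℕ) :
    ∏ z ∈ primitiveRoots (p ^ (n + 1)) K, ‖1 - z‖ = (p : ℝ)⁻¹ := by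
  have : NeZero (p ^ (n + 1)) := ⟨pow_ne_zero _ (Fact.out : p.Prime).ne_zero⟩
  obtain ⟨z, hz⟩ := HasEnoughRootsOfUnity.exists_primitiveRoot K (p ^ (n + 1))
  have h := Polynomial.eval_one_cyclotomic_prime_pow (R := K) (p := p) n
  rw [Polynomial.cyclotomic_eq_prod_X_sub_primitiveRoots hz, Polynomial.eval_prod] at h
  simp only [Polynomial.eval_sub, Polynomial.eval_X, Polynomial.eval_C] at h
  rw [← norm_prod, h, hnp]

theorem norm_one_sub_pow_of_forall_norm_sub_eq {mu : K} {t : ℕ}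
    (h : ∀ j < t, ∀ z, IsPrimitiveRoot z (p ^ (j + 1)) → ‖mu - z‖ = ‖1 - mu‖) :
    ‖1 - mu ^ p ^ t‖ = ‖1 - mu‖ ^ p ^ t := by
  induction t with
  | zero => simp
  | succ t ih =>
    rw [norm_one_sub_pow_succ, ih fun j hj => h j (by omega),
      Finset.prod_congr rfl fun z hz => h t (by omega) z (isPrimitiveRoot_of_mem_primitiveRoots hz),
      Finset.prod_const, card_primitiveRoots_prime_pow, ← pow_add]
    congr 1
    rw [← mul_one_add, Nat.add_sub_cancel' (Fact.out : p.Prime).one_lt.le, pow_succ]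

end Cyclotomic

section PrimePowerRoots

variable {K : Type*} [NontriviallyNormedField K] [IsUltrametricDist K]

theorem norm_sub_le_max_norm (x y : K) : ‖x - y‖ ≤ max ‖x‖ ‖y‖ := by
  simpa [sub_eq_add_neg] using IsUltrametricDist.norm_add_le_max x (-y)

theorem norm_sub_eq_left_of_lt {x y : K} (h : ‖y‖ < ‖x‖) : ‖x - y‖ = ‖x‖ := by
  rw [sub_eq_add_neg, IsUltrametricDist.norm_add_eq_max_of_norm_ne_norm (by simpa using h.ne'),
    norm_neg, max_eq_left h.le]

theorem norm_one_sub_pow_le {z : K} (hz : ‖z‖ = 1) (k : ℕ) : ‖1 - z ^ k‖ ≤ ‖1 - z‖ := by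
  rw [← mul_neg_geom_sum, norm_mul]
  refine mul_le_of_le_one_right (norm_nonneg _) ?_
  exact IsUltrametricDist.norm_sum_le_of_forall_le_of_nonneg zero_le_one fun i _ => by simp [hz]

theorem norm_one_sub_eq_of_isPrimitiveRoot {n : ℕ} (hn : n ≠ 0) {z w : K}
    (hz : IsPrimitiveRoot z n) (hw : IsPrimitiveRoot w n) : ‖1 - z‖ = ‖1 - w‖ := by
  have : NeZero n := ⟨hn⟩
  obtain ⟨i, -, rfl⟩ := hz.eq_pow_of_pow_eq_one hw.pow_eq_one
  obtain ⟨j, -, hj⟩ := hw.eq_pow_of_pow_eq_one hz.pow_eq_one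
  refine le_antisymm ?_ (norm_one_sub_pow_le (norm_eq_one_of_pow_eq_one_of_ne_zero hz.pow_eq_one hn) i)
  conv_lhs => rw [← hj]
  exact norm_one_sub_pow_le (norm_eq_one_of_pow_eq_one_of_ne_zero hw.pow_eq_one hn) j

variable [CharZero K] [IsAlgClosed K] {p : ℕ} [Fact p.Prime]

/-- A primitive `p^n`-th root of unity lies at distance `R(n)` from `1`. -/
theorem norm_one_sub_eq_Rr (hnp : ‖(p : K)‖ = (p : ℝ)⁻¹) {n : ℕ} {z : K}
    (hz : IsPrimitiveRoot z (p ^ (n + 1))) : ‖1 - z‖ = Rr p (n + 1) := by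
  have hp : p.Prime := Fact.out
  have hp2 : (2 : ℝ) ≤ p := by exact_mod_cast hp.two_le
  have hprod := prod_norm_one_sub_primitiveRoots hnp n
  have hpos : p ^ (n + 1) ≠ 0 := pow_ne_zero _ hp.ne_zero
  rw [Finset.prod_congr rfl fun w hw => norm_one_sub_eq_of_isPrimitiveRoot hpos
    (isPrimitiveRoot_of_mem_primitiveRoots hw) hz, Finset.prod_const,
    card_primitiveRoots_prime_pow] at hprod
  have hcard : p ^ n * (p - 1) ≠ 0 :=
    mul_ne_zero (pow_ne_zero _ hp.ne_zero) (Nat.sub_ne_zero_of_lt hp.one_lt)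
  have h1 : (p : ℝ) - 1 ≠ 0 := by linarith
  have h2 : (p : ℝ) ^ n ≠ 0 := by positivity
  have hR : Rr p (n + 1) ^ (p ^ n * (p - 1)) = (p : ℝ)⁻¹ := by
    rw [Rr, if_neg n.succ_ne_zero, ← Real.rpow_natCast, ← Real.rpow_mul (by positivity),
      Nat.cast_mul, Nat.cast_pow, Nat.cast_sub hp.one_lt.le, Nat.cast_one, Nat.add_sub_cancel,
      div_mul_cancel₀ _ (mul_ne_zero h2 h1), Real.rpow_neg_one]
  have hR0 : 0 ≤ Rr p (n + 1) := by
    rw [Rr, if_neg n.succ_ne_zero]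
    positivity
  exact (pow_left_inj₀ (norm_nonneg _) hR0 hcard).1 (hprod.trans hR.symm)

theorem norm_one_sub_pow_add_of_lt (hnp : ‖(p : K)‖ = (p : ℝ)⁻¹) {mu : K} {t : ℕ}
    (h : ‖1 - mu‖ < Rr p (t + 1)) (k : ℕ) :
    ‖1 - mu ^ p ^ (t + k)‖ = ‖1 - mu ^ p ^ t‖ * ((p : ℝ)⁻¹) ^ k := by
  induction k with
  | zero => simp
  | succ k ih =>
    rw [← add_assoc, norm_one_sub_pow_succ, ih, pow_succ, mul_assoc,
      ← prod_norm_one_sub_primitiveRoots hnp (t + k)]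
    congr 2
    refine Finset.prod_congr rfl fun z hz => ?_
    have hz' := norm_one_sub_eq_Rr hnp (isPrimitiveRoot_of_mem_primitiveRoots hz)
    have hle : Rr p (t + 1) ≤ Rr p (t + k + 1) :=
      (Rr_strictMono (Fact.out : p.Prime).two_le).monotone (by omega)
    rw [← norm_sub_eq_left_of_lt (x := 1 - z) (y := 1 - mu) (by rw [hz']; linarith)]
    congr 1
    ring

theorem norm_one_sub_pow_of_Rr_le (hnp : ‖(p : K)‖ = (p : ℝ)⁻¹) {mu : K} {s t : ℕ}
    (h : Rr p s ≤ ‖1 - mu‖) (hts : t < s) : ‖1 - mu ^ p ^ t‖ = ‖1 - mu‖ ^ p ^ t := by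
  refine norm_one_sub_pow_of_forall_norm_sub_eq fun j hj z hz => ?_
  have hlt : Rr p (j + 1) < Rr p s := Rr_strictMono (Fact.out : p.Prime).two_le (by omega)
  rw [← norm_sub_eq_left_of_lt (x := 1 - mu) (y := 1 - z)
    (by rw [norm_one_sub_eq_Rr hnp hz]; linarith), ← norm_neg]
  congr 1
  ring

theorem pow_eq_one_of_norm_one_sub_lt (hnp : ‖(p : K)‖ = (p : ℝ)⁻¹) {z : K} {s : ℕ}
    (hz : z ∈ GammaR p K) (h : ‖1 - z‖ < Rr p (s + 1)) : z ^ p ^ s = 1 := by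
  obtain ⟨k, hk⟩ := hz
  obtain ⟨j, -, hj⟩ := (Nat.dvd_prime_pow Fact.out).1 (orderOf_dvd_of_pow_eq_one hk)
  refine orderOf_dvd_iff_pow_eq_one.1 (hj ▸ pow_dvd_pow p ?_)
  by_contra! hlt
  obtain ⟨i, rfl⟩ := Nat.exists_eq_add_of_lt hlt
  rw [norm_one_sub_eq_Rr hnp (hj ▸ IsPrimitiveRoot.orderOf z)] at h
  exact absurd ((Rr_strictMono (Fact.out : p.Prime).two_le).lt_iff_lt.1 h) (by omega)

/-- The distance of `λ^{p^s}` from `1` in terms of a nearest `p`-power root of unity `γ`. -/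
theorem norm_one_sub_pow_of_nearest (hnp : ‖(p : K)‖ = (p : ℝ)⁻¹) {lam γ : K} {s t : ℕ}
    (hs : ‖1 - lam‖ < Rr p (s + 1)) (hγ : γ ∈ GammaR p K)
    (hmin : ∀ z ∈ GammaR p K, ‖γ - lam‖ ≤ ‖z - lam‖)
    (ht : Rr p t ≤ ‖γ - lam‖) (ht' : ‖γ - lam‖ < Rr p (t + 1)) :
    t ≤ s ∧ ‖1 - lam ^ p ^ s‖ = ‖γ - lam‖ ^ p ^ t * ((p : ℝ)⁻¹) ^ (s - t) := by
  have hR := Rr_strictMono (Fact.out : p.Prime).two_le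
  have hle : ‖γ - lam‖ ≤ ‖1 - lam‖ := hmin 1 ⟨0, one_pow _⟩
  have hts : t ≤ s := Nat.lt_succ_iff.1 (hR.lt_iff_lt.1 ((ht.trans hle).trans_lt hs))
  have hγs : γ ^ p ^ s = 1 := by
    refine pow_eq_one_of_norm_one_sub_lt hnp hγ (lt_of_le_of_lt ?_ hs)
    rw [show 1 - γ = (1 - lam) - (γ - lam) by ring]
    exact (norm_sub_le_max_norm _ _).trans (max_le le_rfl hle)
  have hp0 : p ^ s ≠ 0 := pow_ne_zero _ (Fact.out : p.Prime).ne_zero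
  have hγ1 : ‖γ‖ = 1 := norm_eq_one_of_pow_eq_one_of_ne_zero hγs hp0
  have hγ0 : γ ≠ 0 := norm_ne_zero_iff.1 (by simp [hγ1])
  have hscale : ∀ z, ‖lam / γ - z‖ = ‖γ * z - lam‖ := fun z => by
    rw [← one_mul ‖lam / γ - z‖, ← hγ1, ← norm_mul, mul_sub, mul_div_cancel₀ _ hγ0, norm_sub_rev]
  have hmu : ‖1 - lam / γ‖ = ‖γ - lam‖ := by
    rw [norm_sub_rev, hscale, mul_one]
  refine ⟨hts, ?_⟩
  have hpow : lam ^ p ^ s = (lam / γ) ^ p ^ (t + (s - t)) := by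
    rw [Nat.add_sub_cancel' hts, div_pow, hγs, div_one]
  rw [hpow, norm_one_sub_pow_add_of_lt hnp (hmu ▸ ht'), norm_one_sub_pow_of_forall_norm_sub_eq, hmu]
  intro j hj z hz
  apply le_antisymm
  · rw [show lam / γ - z = (1 - z) - (1 - lam / γ) by ring]
    refine (norm_sub_le_max_norm _ _).trans (max_le ?_ le_rfl)
    rw [norm_one_sub_eq_Rr hnp hz, hmu]
    exact (hR.monotone (by omega)).trans ht
  · rw [hmu, hscale]
    obtain ⟨k, hk⟩ := hγ
    refine hmin _ ⟨k + (j + 1), ?_⟩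
    rw [mul_pow, pow_add p k, pow_mul, hk, one_pow, mul_comm (p ^ k), pow_mul, hz.pow_eq_one,
      one_pow, one_mul]

end PrimePowerRoots

/-- Lemma: the values of the slopes `κ_n`. For `p ≥ 3` and
`0 < |1-λ| < 1` (so `m = 1`): `κ_n = -1/p^n` for `n ≥ s+1`;
`κ_s = -(s-t)p^{-s} - p^{-(s-t)}ν(γ₀-λ) + (1/p)ν(1-λ)` if `s ≥ 1`; and
`κ_n = -((p-1)/p)ν(1-λ)` for `1 ≤ n ≤ s-1` if `s ≥ 2`. -/
theorem stmt15 (p : ℕ) [Fact p.Prime] (hp3 : 3 ≤ p)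
    {K : Type*} [NontriviallyNormedField K] [IsUltrametricDist K] [CompleteSpace K]
    [IsAlgClosed K] [Algebra ℚ_[p] K]
    (hiso : ∀ x : ℚ_[p], ‖algebraMap ℚ_[p] K x‖ = ‖x‖)
    (hdense : Dense {x : K | IsAlgebraic ℚ_[p] x})
    (lam : K) (hroot : ∀ n : ℕ, 1 ≤ n → lam ^ n ≠ 1)
    (hlam1 : 0 < ‖1 - lam‖) (hlam2 : ‖1 - lam‖ < 1)
    (s : ℕ) (hs : Rr p s ≤ ‖1 - lam‖ ∧ ‖1 - lam‖ < Rr p (s + 1))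
    (γ₀ : K) (hγ₀ : γ₀ ∈ GammaR p K)
    (hγmin : ∀ γ ∈ GammaR p K, ‖γ₀ - lam‖ ≤ ‖γ - lam‖)
    (t : ℕ) (ht : Rr p t ≤ ‖γ₀ - lam‖ ∧ ‖γ₀ - lam‖ < Rr p (t + 1))
 :
    (∀ n : ℕ, s + 1 ≤ n → kappaN p lam n = -(1 : ℝ) / (p : ℝ) ^ n) ∧
    (1 ≤ s → kappaN p lam s =
      -((s : ℝ) - (t : ℝ)) * (p : ℝ) ^ (-(s : ℝ)) -
        (p : ℝ) ^ (-((s : ℝ) - (t : ℝ))) * nuP p (γ₀ - lam) +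
        (1 / (p : ℝ)) * nuP p (1 - lam)) ∧
    (2 ≤ s → ∀ n : ℕ, 1 ≤ n → n ≤ s - 1 →
      kappaN p lam n = -(((p : ℝ) - 1) / (p : ℝ)) * nuP p (1 - lam)) := by
  have hp : p.Prime := Fact.out
  have hpR : (1 : ℝ) < p := by exact_mod_cast hp.one_lt
  have hp0 : (p : ℝ) ≠ 0 := by positivity
  have hlogp : Real.logb p (p : ℝ)⁻¹ = -1 := by
    rw [Real.logb_inv, Real.logb_self_eq_one hpR]
  have : CharZero K := charZero_of_injective_algebraMap (algebraMap ℚ_[p] K).injective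
  have hnp : ‖(p : K)‖ = (p : ℝ)⁻¹ := by
    rw [← map_natCast (algebraMap ℚ_[p] K) p, hiso, Padic.norm_p]
  have hne : ∀ n, ‖1 - lam ^ p ^ n‖ ≠ 0 := fun n =>
    norm_ne_zero_iff.2 (sub_ne_zero.2 (hroot _ (Nat.one_le_pow _ _ hp.pos)).symm)
  obtain ⟨hts, hnear⟩ := norm_one_sub_pow_of_nearest hnp hs.2 hγ₀ hγmin ht.1 ht.2
  refine ⟨fun n hn => ?_, fun hs1 => ?_, fun _ n hn hns => ?_⟩
  · obtain ⟨k, rfl⟩ := Nat.exists_eq_add_of_le hn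
    have h : ‖1 - lam ^ p ^ (s + 1 + k)‖ = ‖1 - lam ^ p ^ (s + k)‖ * (p : ℝ)⁻¹ := by
      rw [add_assoc s, add_comm 1, norm_one_sub_pow_add_of_lt hnp hs.2,
        norm_one_sub_pow_add_of_lt hnp hs.2, pow_succ, mul_assoc]
    rw [kappaN, nuP, nuP, show s + 1 + k - 1 = s + k by omega, h,
      Real.logb_mul (hne _) (inv_ne_zero hp0), hlogp]
    ring
  · obtain ⟨r, rfl⟩ := Nat.exists_eq_add_of_le' hs1
    have hγne : ‖γ₀ - lam‖ ≠ 0 := by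
      obtain ⟨k, hk⟩ := hγ₀
      refine norm_ne_zero_iff.2 (sub_ne_zero.2 ?_)
      rintro rfl
      exact hroot _ (Nat.one_le_pow _ _ hp.pos) hk
    rw [kappaN, nuP, nuP, nuP, nuP, hnear, Nat.add_sub_cancel,
      norm_one_sub_pow_of_Rr_le hnp hs.1 r.lt_succ_self,
      Real.logb_mul (pow_ne_zero _ hγne) (pow_ne_zero _ (inv_ne_zero hp0)), Real.logb_pow,
      Real.logb_pow, Real.logb_pow, hlogp, neg_sub ((r + 1 : ℕ) : ℝ) (t : ℝ), Real.rpow_sub (by positivity),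
      Real.rpow_neg (by positivity), Real.rpow_natCast, Real.rpow_natCast, Nat.cast_sub hts]
    push_cast
    field_simp
    ring
  · obtain ⟨r, rfl⟩ := Nat.exists_eq_add_of_le' hn
    rw [kappaN, nuP, nuP, nuP, Nat.add_sub_cancel, norm_one_sub_pow_of_Rr_le hnp hs.1 (by omega),
      norm_one_sub_pow_of_Rr_le hnp hs.1 (by omega), Real.logb_pow, Real.logb_pow]
    push_cast
    field_simp
    ring
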